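/- Let q ≥ 0 and let F ⊆ E be feasible for (2,q)-FGC. Then the family 𝒞 = {A ⊆ V : ∅ ≠ A ⊊ V, |δ_F(A)| = q+2 and |δ_{F∩𝒮}(A)| ≤ 1} of violated cuts for the augmentation from (2,q)-FGC to (2,q+1)-FGC is uncrossable. -/

import Mathlib

open scoped BigOperators

/-- An edge `e` crosses the vertex set `A` if exactly one of its endpoints lies in `A`. -/
def crosses {V E : Type*} (ends : E → Sym2 V) (A : Set V) (e : E) : Prop :=
  ∃ u v : V, ends e = s(u, v) ∧ u ∈ A ∧ v ∉ A

/-- `cut ends F A` is `δ_F(A)`: the set of edges of `F` with exactly one endpoint in `A`. -/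
def cut {V E : Type*} (ends : E → Sym2 V) (F : Set E) (A : Set V) : Set E :=
  {e | e ∈ F ∧ crosses ends A e}

/-- Two vertex sets properly intersect. -/
def properlyIntersect {V : Type*} (A B : Set V) : Prop :=
  (A ∩ B).Nonempty ∧ (A \ B).Nonempty ∧ (B \ A).Nonempty

/-- `F` is feasible for `(p,q)`-FGC. -/
def fgcFeasible {V E : Type*} (ends : E → Sym2 V) (𝒮 : Set E) (p q : ℕ) (F : Set E) : Prop :=
  ∀ A : Set V, A.Nonempty → A ≠ Set.univ →
    p ≤ (cut ends (F ∩ 𝒮) A).ncard ∨ p + q ≤ (cut ends F A).ncard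

/-- Two properly intersecting members of the family `𝒞` uncross. -/
def uncross {V : Type*} (𝒞 : Set (Set V)) (A B : Set V) : Prop :=
  (A ∩ B ∈ 𝒞 ∧ A ∪ B ∈ 𝒞) ∨ (A \ B ∈ 𝒞 ∧ B \ A ∈ 𝒞)

/-- The family `𝒞` is uncrossable. -/
def uncrossable {V : Type*} (𝒞 : Set (Set V)) : Prop :=
  ∀ A B, A ∈ 𝒞 → B ∈ 𝒞 → properlyIntersect A B → uncross 𝒞 A B

theorem crosses_iff_of_ends_eq {V E : Type*} {ends : E → Sym2 V} {e : E} {u v : V}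
    (he : ends e = s(u, v)) (A : Set V) :
    crosses ends A e ↔ (u ∈ A ∧ v ∉ A) ∨ (v ∈ A ∧ u ∉ A) := by
  constructor
  · rintro ⟨x, y, hxy, hx, hy⟩
    rw [he, Sym2.eq_iff] at hxy
    rcases hxy with ⟨rfl, rfl⟩ | ⟨rfl, rfl⟩
    · exact Or.inl ⟨hx, hy⟩
    · exact Or.inr ⟨hx, hy⟩
  · rintro (⟨hu, hv⟩ | ⟨hv, hu⟩)
    · exact ⟨u, v, he, hu, hv⟩
    · exact ⟨v, u, he.trans Sym2.eq_swap, hv, hu⟩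

theorem exists_ends_eq {V E : Type*} (ends : E → Sym2 V) (e : E) :
    ∃ u v, ends e = s(u, v) := by
  induction h : ends e with
  | _ u v => exact ⟨u, v, rfl⟩

theorem cut_compl {V E : Type*} (ends : E → Sym2 V) (F : Set E) (A : Set V) :
    cut ends F Aᶜ = cut ends F A := by
  ext e
  obtain ⟨u, v, he⟩ := exists_ends_eq ends e
  simp only [cut, Set.mem_ofPred_eq, crosses_iff_of_ends_eq he, Set.mem_compl_iff]
  tauto

theorem cut_union_subset {V E : Type*} (ends : E → Sym2 V) (F : Set E) (A B : Set V) :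
    cut ends F (A ∪ B) ⊆ cut ends F A ∪ cut ends F B := by
  intro e
  obtain ⟨u, v, he⟩ := exists_ends_eq ends e
  simp only [cut, Set.mem_ofPred_eq, crosses_iff_of_ends_eq he, Set.mem_union]
  tauto

theorem cut_inter_subset {V E : Type*} (ends : E → Sym2 V) (F : Set E) (A B : Set V) :
    cut ends F (A ∩ B) ⊆ cut ends F A ∪ cut ends F B := by
  rw [← cut_compl ends F (A ∩ B), ← cut_compl ends F A, ← cut_compl ends F B, Set.compl_inter]
  exact cut_union_subset ends F Aᶜ Bᶜ

/-- The cut function is submodular. -/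
theorem ncard_cut_inter_add_ncard_cut_union_le {V E : Type*} [Finite E] (ends : E → Sym2 V)
    (F : Set E) (A B : Set V) :
    (cut ends F (A ∩ B)).ncard + (cut ends F (A ∪ B)).ncard
      ≤ (cut ends F A).ncard + (cut ends F B).ncard := by
  rw [← Set.ncard_union_add_ncard_inter (cut ends F (A ∩ B)),
    ← Set.ncard_union_add_ncard_inter (cut ends F A)]
  refine add_le_add (Set.ncard_le_ncard (Set.union_subset (cut_inter_subset ends F A B)
    (cut_union_subset ends F A B))) (Set.ncard_le_ncard fun e => ?_)
  obtain ⟨u, v, he⟩ := exists_ends_eq ends e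
  simp only [cut, Set.mem_ofPred_eq, crosses_iff_of_ends_eq he, Set.mem_union, Set.mem_inter_iff]
  tauto

/-- The cut function is posimodular. -/
theorem ncard_cut_sdiff_add_ncard_cut_sdiff_le {V E : Type*} [Finite E] (ends : E → Sym2 V)
    (F : Set E) (A B : Set V) :
    (cut ends F (A \ B)).ncard + (cut ends F (B \ A)).ncard
      ≤ (cut ends F A).ncard + (cut ends F B).ncard := by
  have h := ncard_cut_inter_add_ncard_cut_union_le ends F A Bᶜ
  rwa [← cut_compl ends F (A ∪ Bᶜ), Set.compl_union, compl_compl, Set.inter_comm Aᶜ,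
    ← Set.sdiff_eq, ← Set.sdiff_eq, cut_compl] at h

theorem ncard_cut_union_le_add_ncard_cut_sdiff {V E : Type*} [Finite E] (ends : E → Sym2 V)
    (F : Set E) (A B : Set V) :
    (cut ends F (A ∪ B)).ncard ≤ (cut ends F A).ncard + (cut ends F (B \ A)).ncard := by
  rw [← Set.union_sdiff_self]
  exact (Set.ncard_le_ncard (cut_union_subset ends F A (B \ A))).trans (Set.ncard_union_le _ _)

theorem ncard_cut_inter_le_add_ncard_cut_sdiff {V E : Type*} [Finite E] (ends : E → Sym2 V)
    (F : Set E) (A B : Set V) :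
    (cut ends F (A ∩ B)).ncard ≤ (cut ends F A).ncard + (cut ends F (A \ B)).ncard := by
  rw [← Set.sdiff_sdiff_right_self, Set.sdiff_eq, ← cut_compl ends F (A \ B)]
  exact (Set.ncard_le_ncard (cut_inter_subset ends F A (A \ B)ᶜ)).trans (Set.ncard_union_le _ _)

theorem stmt7 {V E : Type*} [Fintype V] [Fintype E]
    (ends : E → Sym2 V) (𝒮 𝒰 : Set E)
    (hpart : 𝒮 ∪ 𝒰 = Set.univ) (hdisj : Disjoint 𝒮 𝒰)
    (q : ℕ) (F : Set E) (hF : fgcFeasible ends 𝒮 2 q F) :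
    uncrossable {A : Set V | A.Nonempty ∧ A ≠ Set.univ ∧
      (cut ends F A).ncard = q + 2 ∧ (cut ends (F ∩ 𝒮) A).ncard ≤ 1} := by
  rintro A B ⟨hA, hA', hdA, hsA⟩ ⟨hB, hB', hdB, hsB⟩ ⟨hI, hAB, hBA⟩
  have hI' : A ∩ B ≠ Set.univ := fun h => hA' (Set.univ_subset_iff.1 (h ▸ Set.inter_subset_left))
  have hAB' : A \ B ≠ Set.univ := fun h => hA' (Set.univ_subset_iff.1 (h ▸ Set.sdiff_subset))
  have hBA' : B \ A ≠ Set.univ := fun h => hB' (Set.univ_subset_iff.1 (h ▸ Set.sdiff_subset))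
  simp only [uncross, Set.mem_ofPred_eq, hI, hAB, hBA, hI', hAB', hBA', hI.mono
    (Set.inter_subset_left.trans Set.subset_union_left), ne_eq, not_false_eq_true, true_and]
  by_cases hU : A ∪ B = Set.univ
  · have hABc : A \ B = Bᶜ := by rw [← Set.union_sdiff_right, hU, Set.compl_eq_univ_sdiff]
    have hBAc : B \ A = Aᶜ := by rw [← Set.union_sdiff_left, hU, Set.compl_eq_univ_sdiff]
    rw [hABc, hBAc]
    simp only [cut_compl]
    exact Or.inr ⟨⟨hdB, hsB⟩, hdA, hsA⟩
  · have fI := hF _ hI hI'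
    have fAB := hF _ hAB hAB'
    have fBA := hF _ hBA hBA'
    have fU := hF _ (hI.mono (Set.inter_subset_left.trans Set.subset_union_left)) hU
    have d₁ := ncard_cut_inter_add_ncard_cut_union_le ends F A B
    have d₂ := ncard_cut_sdiff_add_ncard_cut_sdiff_le ends F A B
    have s₁ := ncard_cut_inter_add_ncard_cut_union_le ends (F ∩ 𝒮) A B
    have s₂ := ncard_cut_sdiff_add_ncard_cut_sdiff_le ends (F ∩ 𝒮) A B
    have iA := ncard_cut_inter_le_add_ncard_cut_sdiff ends (F ∩ 𝒮) A B
    have iB := ncard_cut_inter_le_add_ncard_cut_sdiff ends (F ∩ 𝒮) B A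
    have uA := ncard_cut_union_le_add_ncard_cut_sdiff ends (F ∩ 𝒮) A B
    have uB := ncard_cut_union_le_add_ncard_cut_sdiff ends (F ∩ 𝒮) B A
    rw [Set.inter_comm B A] at iB
    rw [Set.union_comm B A] at uB
    simp only [hU, not_false_eq_true, true_and]
    omega
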